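/- The infinite series with n ranging over positive integers of 2^(2n) / (n * (2n+1) * binom(2n, n)) converges and its sum equals 2. -/

import Mathlib

/-- The telescoping sequence `4 ^ m / (m * C(2m, m))`, indexed by `m = n + 1`. -/
noncomputable def centralBinomRatio (n : ℕ) : ℝ :=
  (4:ℝ)^(n+1) / (((n:ℝ)+1) * (Nat.centralBinom (n+1) : ℝ))

theorem centralBinomRatio_zero : centralBinomRatio 0 = 2 := by
  norm_num [centralBinomRatio, Nat.centralBinom, Nat.choose]

theorem centralBinomRatio_succ (n : ℕ) :
    centralBinomRatio (n+1) = centralBinomRatio n * ((2*(n:ℝ)+2) / (2*(n:ℝ)+3)) := by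
  have h : ((n:ℝ)+2) * (Nat.centralBinom (n+2) : ℝ)
      = 2 * (2*(n:ℝ)+3) * (Nat.centralBinom (n+1) : ℝ) := by
    have := congrArg (Nat.cast : ℕ → ℝ) (Nat.succ_mul_centralBinom_succ (n+1))
    push_cast at this
    linear_combination this
  have hc : (Nat.centralBinom (n+1) : ℝ) ≠ 0 := by
    exact_mod_cast Nat.centralBinom_ne_zero (n+1)
  have hn : ((n+1 : ℕ) : ℝ) + 1 = (n:ℝ) + 2 := by push_cast; ring
  unfold centralBinomRatio
  rw [hn, h]
  field_simp
  ring

theorem centralBinomRatio_nonneg (n : ℕ) : 0 ≤ centralBinomRatio n := by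
  unfold centralBinomRatio
  positivity

theorem centralBinomRatio_sq_le (n : ℕ) : centralBinomRatio n ^ 2 ≤ 4 / ((n:ℝ)+1) := by
  induction n with
  | zero => norm_num [centralBinomRatio_zero]
  | succ n ih =>
    rw [centralBinomRatio_succ, mul_pow]
    calc _ ≤ 4 / ((n:ℝ)+1) * ((2*(n:ℝ)+2) / (2*(n:ℝ)+3)) ^ 2 := by gcongr
      _ ≤ _ := by
        push_cast
        rw [div_pow, div_mul_div_comm, div_le_div_iff₀ (by positivity) (by positivity)]
        have hn : (0:ℝ) ≤ n := n.cast_nonneg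
        nlinarith

theorem tendsto_centralBinomRatio :
    Filter.Tendsto centralBinomRatio Filter.atTop (nhds 0) := by
  have h : Filter.Tendsto (fun n : ℕ => 4 / ((n:ℝ)+1)) Filter.atTop (nhds 0) := by
    simpa [div_eq_mul_inv] using
      (tendsto_one_div_add_atTop_nhds_zero_nat (𝕜 := ℝ)).const_mul 4
  have hs := h.sqrt
  rw [Real.sqrt_zero] at hs
  exact squeeze_zero centralBinomRatio_nonneg
    (fun n => Real.le_sqrt_of_sq_le (centralBinomRatio_sq_le n)) hs

theorem centralBinomRatio_sub_succ (n : ℕ) :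
    (2:ℝ)^(2*(n+1)) /
        (((n:ℝ)+1) * (2*((n:ℝ)+1)+1) * (Nat.choose (2*(n+1)) (n+1) : ℝ))
      = centralBinomRatio n - centralBinomRatio (n+1) := by
  have hc : (Nat.centralBinom (n+1) : ℝ) ≠ 0 := by
    exact_mod_cast Nat.centralBinom_ne_zero (n+1)
  rw [centralBinomRatio_succ, ← Nat.centralBinom_eq_two_mul_choose, pow_mul, centralBinomRatio]
  have h3 : 2*((n:ℝ)+1)+1 = 2*(n:ℝ)+3 := by ring
  rw [h3]
  norm_num only
  field_simp
  ring

/-- The series `Σ_{n≥1} 2^(2n) / (n (2n+1) C(2n,n))` converges with sum `2`. -/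
theorem stmt_2 :
    HasSum (fun n : ℕ =>
      (2:ℝ)^(2*(n+1)) /
        (((n:ℝ)+1) * (2*((n:ℝ)+1)+1) * (Nat.choose (2*(n+1)) (n+1) : ℝ))) 2 := by
  rw [hasSum_iff_tendsto_nat_of_nonneg (fun n => by positivity)]
  simp_rw [centralBinomRatio_sub_succ, Finset.sum_range_sub', centralBinomRatio_zero]
  simpa using tendsto_centralBinomRatio.const_sub 2
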